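/- arXiv:2208.03765 — 2 statements merged into one kernel-verified Lean document; each statement's English description precedes it below -/
import Mathlib

section
/- Let (M;F) be a multi-algebra over a signature. Define an algebra structure on A = Pow₊M by setting, for each n-ary f ∈ F: f({m₁},…,{mₙ}) = f(m₁,…,mₙ) (the value of the multi-operation, a nonempty subset of M, regarded as an element of A) whenever all arguments are singletons, and f(B₁,…,Bₙ) = M otherwise. Then the non-disjointness relation ν on A is a tolerance on this algebra (A;F). -/
/-- `Pow₊ M`: the set of all nonempty subsets of `M`. -/
def PowPlus (M : Type*) : Type _ := {S : Set M // S.Nonempty}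

/-- The non-disjointness relation `ν` on `Pow₊ M`: `(X, Y) ∈ ν` iff `X ∩ Y ≠ ∅`. -/
def nu {M : Type*} (X Y : PowPlus M) : Prop := (X.1 ∩ Y.1).Nonempty

/-- `τ` is a tolerance on the algebra with operations `op` (indexed by the operation
symbols `f : F` of arity `arity f`): a reflexive, symmetric binary relation with the
substitution property. -/
def IsTolerance {F : Type*} {arity : F → ℕ} {A : Type*}
    (op : ∀ f : F, (Fin (arity f) → A) → A) (τ : A → A → Prop) : Prop :=
  (∀ a : A, τ a a) ∧ (∀ a b : A, τ a b → τ b a) ∧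
  ∀ (f : F) (a b : Fin (arity f) → A), (∀ i, τ (a i) (b i)) → τ (op f a) (op f b)

/-- The algebra structure on `A = Pow₊ M` induced by a multi-algebra `(M; F)` with
multi-operations `mop` (whose values are nonempty, by `hne`): on singletons,
`f({m₁},…,{mₙ}) = f(m₁,…,mₙ)`, and `f(B₁,…,Bₙ) = M` otherwise. -/
noncomputable def powOp {F : Type*} (arity : F → ℕ) {M : Type*} [Nonempty M]
    (mop : ∀ f : F, (Fin (arity f) → M) → Set M)
    (hne : ∀ (f : F) (m : Fin (arity f) → M), (mop f m).Nonempty)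
    (f : F) (B : Fin (arity f) → PowPlus M) : PowPlus M :=
  letI := Classical.dec (∃ m : Fin (arity f) → M, ∀ i, (B i).1 = {m i})
  if h : ∃ m : Fin (arity f) → M, ∀ i, (B i).1 = {m i}
  then ⟨mop f h.choose, hne f h.choose⟩
  else ⟨Set.univ, Set.univ_nonempty⟩

theorem powOp_val_of_eq_singleton {F : Type*} (arity : F → ℕ) {M : Type*} [Nonempty M]
    (mop : ∀ f : F, (Fin (arity f) → M) → Set M)
    (hne : ∀ (f : F) (m : Fin (arity f) → M), (mop f m).Nonempty)
    {f : F} {B : Fin (arity f) → PowPlus M} {m : Fin (arity f) → M}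
    (hm : ∀ i, (B i).1 = {m i}) : (powOp arity mop hne f B).1 = mop f m := by
  have h : ∃ m : Fin (arity f) → M, ∀ i, (B i).1 = {m i} := ⟨m, hm⟩
  have hc : h.choose = m := funext fun i =>
    Set.singleton_injective ((h.choose_spec i).symm.trans (hm i))
  exact (congrArg Subtype.val (dif_pos h)).trans (congrArg (mop f) hc)

theorem powOp_val_of_not_singleton {F : Type*} (arity : F → ℕ) {M : Type*} [Nonempty M]
    (mop : ∀ f : F, (Fin (arity f) → M) → Set M)
    (hne : ∀ (f : F) (m : Fin (arity f) → M), (mop f m).Nonempty)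
    {f : F} {B : Fin (arity f) → PowPlus M}
    (h : ¬ ∃ m : Fin (arity f) → M, ∀ i, (B i).1 = {m i}) :
    (powOp arity mop hne f B).1 = Set.univ := by
  exact congrArg Subtype.val (dif_neg h)

theorem nu_refl {M : Type*} (X : PowPlus M) : nu X X := by
  rw [nu, Set.inter_self]
  exact X.2

theorem nu_symm {M : Type*} {X Y : PowPlus M} (h : nu X Y) : nu Y X := by
  rwa [nu, Set.inter_comm]

theorem nu_of_val_eq_univ {M : Type*} {X Y : PowPlus M} (h : X.1 = Set.univ) : nu X Y := by
  rw [nu, h, Set.univ_inter]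
  exact Y.2

/-- For any multi-algebra `(M; F)`, the non-disjointness relation `ν` is a tolerance
on the algebra `(Pow₊ M; F)` defined by `powOp`. -/
theorem nu_is_tolerance_powOp {F : Type*} (arity : F → ℕ) {M : Type*} [Nonempty M]
    (mop : ∀ f : F, (Fin (arity f) → M) → Set M)
    (hne : ∀ (f : F) (m : Fin (arity f) → M), (mop f m).Nonempty) :
    IsTolerance (powOp arity mop hne) (nu (M := M)) := by
  refine ⟨nu_refl, fun _ _ => nu_symm, fun f a b hab => ?_⟩
  by_cases ha : ∃ m : Fin (arity f) → M, ∀ i, (a i).1 = {m i}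
  · by_cases hb : ∃ m : Fin (arity f) → M, ∀ i, (b i).1 = {m i}
    · obtain ⟨m, hm⟩ := ha
      obtain ⟨n, hn⟩ := hb
      have hmn : m = n := funext fun i => by
        obtain ⟨x, hxa, hxb⟩ := hab i
        rw [hm i] at hxa
        rw [hn i] at hxb
        exact hxa.symm.trans hxb
      subst hmn
      rw [nu, powOp_val_of_eq_singleton arity mop hne hm,
        powOp_val_of_eq_singleton arity mop hne hn, Set.inter_self]
      exact hne f m
    · exact nu_symm (nu_of_val_eq_univ (powOp_val_of_not_singleton arity mop hne hb))
  · exact nu_of_val_eq_univ (powOp_val_of_not_singleton arity mop hne ha)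
end

section
/- Let M be a nonempty set, let A = Pow₊M, and let ν be the non-disjointness relation on A. For m ∈ M let M_m = { S ∈ A : m ∈ S } (the principal filter at m), and let 𝒞 = { M_m : m ∈ M }. Then 𝒞 is a full covering of A with respect to ν: each M_m is a maximal clique of ν, the members of 𝒞 are pairwise incomparable under set inclusion, their union is A, and for all X,Y ∈ A one has (X,Y) ∈ ν if and only if there is m ∈ M with X ∈ M_m and Y ∈ M_m. -/
/-- `B` is a clique of the binary relation `τ`: any two elements of `B` are related. -/
def IsClique {A : Type*} (τ : A → A → Prop) (B : Set A) : Prop :=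
  ∀ a ∈ B, ∀ b ∈ B, τ a b

/-- `B` is a maximal clique of `τ`: a clique maximal with respect to set inclusion. -/
def IsMaxClique {A : Type*} (τ : A → A → Prop) (B : Set A) : Prop :=
  IsClique τ B ∧ ∀ C : Set A, IsClique τ C → B ⊆ C → B = C

/-- The principal filter at `m`: `M_m = { S ∈ Pow₊ M : m ∈ S }`. -/
def principalFilter {M : Type*} (m : M) : Set (PowPlus M) := {S | m ∈ S.1}

theorem isMaxClique_principalFilter {M : Type*} (m : M) :
    IsMaxClique nu (principalFilter m) := by
  refine ⟨fun X hX Y hY => ⟨m, hX, hY⟩, fun C hC hsub => hsub.antisymm fun S hS => ?_⟩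
  obtain ⟨x, hxS, rfl⟩ :=
    hC S hS ⟨{m}, Set.singleton_nonempty m⟩ (hsub (Set.mem_singleton m))
  exact hxS

theorem eq_of_principalFilter_subset {M : Type*} {m m' : M}
    (h : principalFilter m ⊆ principalFilter m') : m = m' := by
  have hm : (⟨{m}, Set.singleton_nonempty m⟩ : PowPlus M) ∈ principalFilter m' :=
    h (Set.mem_singleton m)
  exact (Set.mem_singleton_iff.mp hm).symm

/-- For a nonempty set `M`, the collection `𝒞 = { M_m : m ∈ M }` of principal filters
is a full covering of `A = Pow₊ M` with respect to the non-disjointness relation `ν`: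
each `M_m` is a maximal clique of `ν`, distinct members of `𝒞` are incomparable under
inclusion, their union is `A`, and `ν` is recovered from `𝒞`. -/
theorem principalFilters_full_covering (M : Type*) [Nonempty M] :
    (∀ m : M, IsMaxClique nu (principalFilter m)) ∧
    (∀ m m' : M, principalFilter m ≠ principalFilter m' →
      ¬ principalFilter m ⊆ principalFilter m') ∧
    (∀ X : PowPlus M, ∃ m : M, X ∈ principalFilter m) ∧
    (∀ X Y : PowPlus M,
      nu X Y ↔ ∃ m : M, X ∈ principalFilter m ∧ Y ∈ principalFilter m) := by
  exact ⟨isMaxClique_principalFilter,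
    fun _ _ hne hsub => hne (congrArg principalFilter (eq_of_principalFilter_subset hsub)),
    fun X => X.2, fun _ _ => Iff.rfl⟩
end
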